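/- arXiv:0710.0810 — 3 statements merged into one kernel-verified Lean document; each statement's English description precedes it below -/
import Mathlib

section
/- Every algebraically closed field of characteristic 0 possesses a nonidentity involution. -/
open Polynomial IntermediateField

theorem aux_map {R S : Type*} [Semiring R] [Semiring S] (f : R →+* S) {x : R} (h : IsSumSq x) :
    IsSumSq (f x) := by
  induction h with
  | zero => simp
  | sq_add a hs ih => rw [map_add, map_mul]; exact IsSumSq.sq_add _ ih

theorem aux_cancel {K : Type*} [Field K] (h : ¬ IsSumSq (-1 : K)) {a s : K} (hs : IsSumSq s)
    (e : a * a + s = 0) : a = 0 := by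
  by_contra ha
  apply h
  have : (-1 : K) = (a⁻¹ * a⁻¹) * s := by
    rw [eq_neg_of_add_eq_zero_right e]; field_simp
  rw [this]
  exact (IsSumSq.mul_self _).mul hs

theorem aux_inv {K : Type*} [Field K] {t : K} (ht : IsSumSq t) : IsSumSq t⁻¹ := by
  by_cases h : t = 0
  · simp [h]
  have : t⁻¹ = (t⁻¹ * t⁻¹) * t := by field_simp
  rw [this]
  exact (IsSumSq.mul_self _).mul ht

theorem aux_add {K : Type*} [Field K] (h : ¬ IsSumSq (-1 : K)) {r s : K} (hr : IsSumSq r)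
    (hs : IsSumSq s) (e : r + s = 0) : r = 0 := by
  by_contra h0
  apply h
  have : (-1 : K) = r⁻¹ * s := by
    rw [eq_neg_of_add_eq_zero_right e]; field_simp
  rw [this]
  exact (aux_inv hr).mul hs

theorem aux_lc {K : Type*} [Field K] (h : ¬ IsSumSq (-1 : K)) {p : K[X]} (hp : IsSumSq p) :
    Even p.natDegree ∧ IsSumSq p.leadingCoeff := by
  induction hp with
  | zero => simp
  | @sq_add a s hs ih =>
    by_cases ha : a = 0
    · simpa [ha] using ih
    have he : Even (a * a).natDegree := by
      rw [natDegree_mul ha ha]; exact ⟨_, rfl⟩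
    have hl : IsSumSq (a * a).leadingCoeff := by rw [leadingCoeff_mul]; exact .mul_self _
    rcases lt_trichotomy (a * a).degree s.degree with hlt | heq | hgt
    · rw [leadingCoeff_add_of_degree_lt hlt, natDegree_add_eq_right_of_degree_lt hlt]; exact ih
    · have hne : (a * a).leadingCoeff + s.leadingCoeff ≠ 0 := by
        intro e
        rw [leadingCoeff_mul] at e
        exact ha (leadingCoeff_eq_zero.1 (aux_cancel h ih.2 e))
      rw [leadingCoeff_add_of_degree_eq heq hne]
      refine ⟨?_, hl.add ih.2⟩
      have := degree_add_eq_of_leadingCoeff_add_ne_zero hne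
      rw [← heq, max_self] at this
      rwa [natDegree_eq_natDegree this]
    · rw [leadingCoeff_add_of_degree_lt' hgt, natDegree_add_eq_left_of_degree_lt hgt]
      exact ⟨he, hl⟩

theorem aux_poly_semireal {K : Type*} [Field K] (h : ¬ IsSumSq (-1 : K)) {q p : K[X]}
    (hp : IsSumSq p) (e : q * q + p = 0) : q = 0 := by
  have := (aux_lc h hp).2
  rw [eq_neg_of_add_eq_zero_right e, leadingCoeff_neg, leadingCoeff_mul] at this
  exact leadingCoeff_eq_zero.1 (aux_cancel h this (by ring))

theorem aux_trans {K F : Type*} [Field K] [Field F] [Algebra K F] (h : ¬ IsSumSq (-1 : K)) (t : F)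
    (ht : Transcendental K t) : ¬ IsSumSq (-1 : K⟮t⟯) := by
  have key : ∀ z : K⟮t⟯, IsSumSq z → ∃ p q : K[X], q ≠ 0 ∧ IsSumSq p ∧
      aeval t p = z * (aeval t q) ^ 2 := by
    intro z hz
    induction hz with
    | zero => exact ⟨0, 1, by simp⟩
    | sq_add a hs ih =>
      obtain ⟨p, q, hq, hp, e⟩ := ih
      obtain ⟨r, s, hrs⟩ := (mem_adjoin_simple_iff K (a : F)).1 a.2
      by_cases hs0 : s = 0
      · refine ⟨p, q, hq, hp, ?_⟩
        rw [hs0] at hrs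
        simp at hrs
        simp [hrs, e]
      · refine ⟨(r * q) * (r * q) + (s * s) * p, s * q, mul_ne_zero hs0 hq,
          IsSumSq.sq_add _ ((IsSumSq.mul_self _).mul hp), ?_⟩
        have : aeval t s ≠ 0 := fun h0 => hs0 ((transcendental_iff.1 ht) _ h0)
        simp only [map_add, map_mul, e, hrs, AddMemClass.coe_add, MulMemClass.coe_mul]
        field_simp
  intro hc
  obtain ⟨p, q, hq, hp, e⟩ := key _ hc
  apply hq
  apply aux_poly_semireal h hp
  apply transcendental_iff.1 ht
  simp [e]; ring

theorem aux_small {K F : Type*} [Field K] [Field F] [Algebra K F] {x : F} (hx : IsIntegral K x)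
    (z : K⟮x⟯) : ∃ p : K[X], p.natDegree < (minpoly K x).natDegree ∧ aeval x p = z := by
  obtain ⟨p, hp, e⟩ := (adjoin.powerBasis hx).exists_eq_aeval z
  refine ⟨p, by simpa using hp, ?_⟩
  rw [e]
  simp

theorem aux_oddfac {K : Type*} [Field K] (n : ℕ) : ∀ f : K[X], f.natDegree = n → Odd n →
    ∃ g, Irreducible g ∧ g ∣ f ∧ Odd g.natDegree := by
  induction n using Nat.strong_induction_on with
  | _ n ih =>
  intro f hf hn
  have hu : ¬ IsUnit f := fun hu => by
    rw [natDegree_eq_zero_of_isUnit hu] at hf; subst hf; simp at hn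
  have h0 : f ≠ 0 := by rintro rfl; simp at hf; subst hf; simp at hn
  obtain ⟨g, hg, k, rfl⟩ := WfDvdMonoid.exists_irreducible_factor hu h0
  have hk0 : k ≠ 0 := right_ne_zero_of_mul h0
  rw [natDegree_mul hg.ne_zero hk0] at hf
  by_cases ho : Odd g.natDegree
  · exact ⟨g, hg, dvd_mul_right _ _, ho⟩
  · have := hg.natDegree_pos
    have hk : Odd k.natDegree := by grind
    obtain ⟨g', h1, h2, h3⟩ := ih k.natDegree (by lia) k rfl hk
    exact ⟨g', h1, h2.mul_left _, h3⟩

theorem aux_odd {K F : Type*} [Field K] [Field F] [Algebra K F] [IsAlgClosed F]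
    (h : ¬ IsSumSq (-1 : K)) (n : ℕ) : ∀ x : F, (minpoly K x).natDegree = n → Odd n →
    ¬ IsSumSq (-1 : K⟮x⟯) := by
  induction n using Nat.strong_induction_on with
  | _ n ih =>
  intro x hxn hn hc
  have hx : IsIntegral K x := by
    by_contra h0
    rw [minpoly.eq_zero h0] at hxn; simp at hxn; subst hxn; simp at hn
  have key : ∀ z : K⟮x⟯, IsSumSq z → ∃ p : K[X], IsSumSq p ∧ p.natDegree ≤ 2 * n - 2 ∧
      aeval x p = z := by
    intro z hz
    induction hz with
    | zero => exact ⟨0, by simp⟩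
    | sq_add a hs ih =>
      obtain ⟨p, hp, hd, e⟩ := ih
      obtain ⟨r, hr, er⟩ := aux_small hx a
      refine ⟨r * r + p, .sq_add _ hp, ?_, by simp [e, er]⟩
      refine natDegree_add_le_of_degree_le (natDegree_mul_le.trans ?_) hd
      lia
  obtain ⟨p, hp, hd, e⟩ := key _ hc
  have hp1 : IsSumSq (1 * 1 + p) := .sq_add _ hp
  have hne : 1 * 1 + p ≠ 0 := fun e => one_ne_zero (aux_poly_semireal h hp e)
  obtain ⟨k, hk⟩ := minpoly.dvd K x (p := 1 * 1 + p) (by simp [e])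
  have hev := (aux_lc h hp1).1
  have hk0 : k ≠ 0 := by rintro rfl; simp at hk; simp [hk] at hne
  have hd2 : (1 * 1 + p).natDegree ≤ 2 * n - 2 :=
    natDegree_add_le_of_degree_le (by simp) hd
  rw [hk, natDegree_mul (minpoly.ne_zero hx) hk0, hxn] at hev hd2
  have hko : Odd k.natDegree := by grind
  obtain ⟨g, hg, hgk, hgo⟩ := aux_oddfac _ k rfl hko
  obtain ⟨y, hy⟩ := IsAlgClosed.exists_aeval_eq_zero F g hg.degree_pos.ne'
  have hgd := natDegree_le_of_dvd hgk hk0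
  have hmin : (minpoly K y).natDegree = g.natDegree := by
    rw [← minpoly.eq_of_irreducible hg hy, natDegree_mul_C]
    simpa using hg.ne_zero
  refine ih g.natDegree (by grind) y hmin hgo ?_
  have h1 : aeval (AdjoinSimple.gen K y) p = -1 := by
    apply Subtype.ext
    have : aeval y (1 * 1 + p) = 0 := by
      rw [hk]; obtain ⟨m, rfl⟩ := hgk; simp [hy]
    simp at this ⊢
    exact eq_neg_of_add_eq_zero_right this
  rw [← h1]
  exact aux_map (aeval (AdjoinSimple.gen K y)).toRingHom hp

theorem aux_two {K F : Type*} [Field K] [Field F] [Algebra K F] {x : F} {a : K}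
    (hx : x * x = algebraMap K F a) (z : K⟮x⟯) :
    ∃ u v : K, (z : F) = algebraMap K F u + algebraMap K F v * x := by
  have hm : (X ^ 2 - C a : K[X]).Monic := monic_X_pow_sub_C a two_ne_zero
  have h0 : aeval x (X ^ 2 - C a : K[X]) = 0 := by simp [pow_two, hx]
  obtain ⟨p, hp, e⟩ := aux_small ⟨_, hm, h0⟩ z
  have h2 := natDegree_le_of_dvd (minpoly.dvd K x h0) hm.ne_zero
  rw [natDegree_X_pow_sub_C] at h2
  obtain ⟨v, u, rfl⟩ := exists_eq_X_add_C_of_natDegree_le_one (p := p) (by lia)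
  exact ⟨u, v, by rw [← e]; simp [add_comm]⟩

theorem aux_sqrt {K F : Type*} [Field K] [Field F] [Algebra K F]
    (h : ¬ IsSumSq (-1 : K)) {x : F} {a : K} (hx : x * x = algebraMap K F (-a))
    (ha : ¬ IsSumSq a) (hxK : x ∉ (algebraMap K F).range) : ¬ IsSumSq (-1 : K⟮x⟯) := by
  have key : ∀ z : K⟮x⟯, IsSumSq z → ∃ s t w : K, IsSumSq s ∧ IsSumSq t ∧
      (z : F) = algebraMap K F (s - a * t) + algebraMap K F w * x := by
    intro z hz
    induction hz with
    | zero => exact ⟨0, 0, 0, by simp⟩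
    | sq_add b hs ih =>
      obtain ⟨s, t, w, hs, ht, e⟩ := ih
      obtain ⟨u, v, e2⟩ := aux_two hx b
      refine ⟨u * u + s, v * v + t, 2 * u * v + w, .sq_add _ hs, .sq_add _ ht, ?_⟩
      simp only [AddMemClass.coe_add, MulMemClass.coe_mul, e, e2]
      simp only [map_add, map_sub, map_mul, map_neg, map_ofNat] at hx ⊢
      linear_combination (algebraMap K F v) ^ 2 * hx
  intro hc
  obtain ⟨s, t, w, hs, ht, e⟩ := key _ hc
  have hw : w = 0 := by
    by_contra hw
    apply hxK
    refine ⟨(-1 - (s - a * t)) / w, ?_⟩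
    have : algebraMap K F w ≠ 0 := by simpa using hw
    simp only [map_div₀]
    rw [div_eq_iff this, map_sub]
    simp at e ⊢
    linear_combination e
  have e' : -1 = s - a * t := by
    apply (algebraMap K F).injective
    simpa [hw] using e
  have ht0 : t ≠ 0 := by
    rintro rfl; apply h; rw [e']; simpa using hs
  apply ha
  have : a = (1 * 1 + s) * t⁻¹ := by field_simp; linear_combination e'
  rw [this]
  exact (IsSumSq.sq_add _ hs).mul (aux_inv ht)

theorem aux_zorn (F : Type*) [Field F] [CharZero F] :
    ∃ P : Subfield F, Maximal (fun S : Subfield F => ¬ IsSumSq (-1 : S)) P := by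
  have := zorn_le_nonempty₀ {S : Subfield F | ¬ IsSumSq (-1 : S)} (by
    intro c hc hch S₀ hS₀
    refine ⟨sSup c, ?_, fun z hz => le_sSup hz⟩
    have key : ∀ z : (sSup c : Subfield F), IsSumSq z → ∃ T ∈ c, ∃ y : T, IsSumSq y ∧
        (y : F) = z := by
      intro z hz
      induction hz with
      | zero => exact ⟨S₀, hS₀, 0, by simp⟩
      | sq_add a hs ih =>
        obtain ⟨T, hT, y, hy, e⟩ := ih
        obtain ⟨T', hT', ha⟩ := (Subfield.mem_sSup_of_directedOn ⟨S₀, hS₀⟩ hch.directedOn).1 a.2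
        obtain ⟨U, hU, h1, h2⟩ := hch.directedOn T hT T' hT'
        refine ⟨U, hU, ⟨a, h2 ha⟩ * ⟨a, h2 ha⟩ + Subfield.inclusion h1 y,
          .sq_add _ (aux_map _ hy), ?_⟩
        simp [← e]
        rfl
    intro hbad
    obtain ⟨T, hT, y, hy, e⟩ := key _ hbad
    apply hc hT
    have : y = -1 := by apply Subtype.ext; simpa using e
    rwa [← this]) (algebraMap ℚ F).fieldRange (by
    intro hbad
    let e := RingEquiv.ofBijective (algebraMap ℚ F).rangeRestrictField
      (algebraMap ℚ F).rangeRestrictField_bijective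
    have := (aux_map e.symm.toRingHom hbad).nonneg
    simp at this
    norm_num at this)
  obtain ⟨P, -, hP⟩ := this
  exact ⟨P, hP⟩

theorem aux_max {F : Type*} [Field F] {P : Subfield F}
    (hP : Maximal (fun S : Subfield F => ¬ IsSumSq (-1 : S)) P) {x : F}
    (hx : ¬ IsSumSq (-1 : P⟮x⟯)) : x ∈ P := by
  have h1 : P ≤ P⟮x⟯.toSubfield := fun y hy => P⟮x⟯.algebraMap_mem ⟨y, hy⟩
  exact hP.2 (y := P⟮x⟯.toSubfield) hx h1 (mem_adjoin_simple_self P x)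

theorem aux_rc {F : Type*} [Field F] [IsAlgClosed F] {P : Subfield F}
    (hP : Maximal (fun S : Subfield F => ¬ IsSumSq (-1 : S)) P) : IsRealClosed P := by
  have hsr := hP.1
  have sq1 : ∀ a : P, ¬ IsSumSq a → IsSquare (-a) := by
    intro a ha
    obtain ⟨x, hx⟩ := IsAlgClosed.exists_pow_nat_eq (algebraMap P F (-a)) two_pos
    rw [pow_two] at hx
    by_cases hxP : x ∈ P
    · exact ⟨⟨x, hxP⟩, Subtype.ext hx.symm⟩
    · exact absurd (aux_max hP (aux_sqrt hsr hx ha (by rintro ⟨y, rfl⟩; exact hxP y.2))) hxP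
  have : IsSemireal P := isSemireal_iff_not_isSumSq_neg_one.2 hsr
  refine ⟨fun a => ?_, fun {f} hf => ?_⟩
  · by_cases ha : IsSumSq a
    · by_cases ha' : IsSumSq (-a)
      · have := aux_add hsr ha ha' (by ring)
        left; rw [this]; exact ⟨0, by simp⟩
      · left; simpa using sq1 _ ha'
    · exact Or.inr (sq1 a ha)
  · obtain ⟨g, hg, ⟨k, rfl⟩, hgo⟩ := aux_oddfac _ f rfl hf
    obtain ⟨y, hy⟩ := IsAlgClosed.exists_aeval_eq_zero F g hg.degree_pos.ne'
    have hmin : (minpoly P y).natDegree = g.natDegree := by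
      rw [← minpoly.eq_of_irreducible hg hy, natDegree_mul_C]
      simpa using hg.ne_zero
    have hyP := aux_max hP (aux_odd hsr _ y hmin hgo)
    refine ⟨⟨y, hyP⟩, ?_⟩
    have : g.eval (⟨y, hyP⟩ : P) = 0 := by
      apply (algebraMap P F).injective
      rw [map_zero, ← hy, ← aeval_algebraMap_apply_eq_algebraMap_eval]; rfl
    simp [IsRoot, this]

theorem aux_alg {F : Type*} [Field F] {P : Subfield F}
    (hP : Maximal (fun S : Subfield F => ¬ IsSumSq (-1 : S)) P) : Algebra.IsAlgebraic P F := by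
  refine ⟨fun x => ?_⟩
  by_contra hx
  have := aux_max hP (aux_trans hP.1 x hx)
  exact hx (isAlgebraic_algebraMap (⟨x, this⟩ : P))

theorem aux_sqK {K F : Type*} [Field K] [Field F] [Algebra K F] [IsRealClosed K] {i : F}
    (hi : i * i = -1) (z : K⟮i⟯) : IsSquare z := by
  have hsr : ¬ IsSumSq (-1 : K) := IsSemireal.not_isSumSq_neg_one K
  have : CharZero K := inferInstance
  obtain ⟨a, b, e⟩ := aux_two (a := (-1 : K)) (x := i) (by simp [hi]) z
  suffices h : ∃ u v : K, u * u - v * v = a ∧ 2 * u * v = b by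
    obtain ⟨u, v, h1, h2⟩ := h
    refine ⟨algebraMap K _ u + algebraMap K _ v * AdjoinSimple.gen K i, Subtype.ext ?_⟩
    simp [e, ← h1, ← h2]
    rw [map_ofNat]
    linear_combination -(algebraMap K F v) ^ 2 * hi
  by_cases hb : b = 0
  · rcases IsRealClosed.isSquare_or_isSquare_neg a with ⟨u, hu⟩ | ⟨u, hu⟩
    · exact ⟨u, 0, by simp [hu, hb]⟩
    · exact ⟨0, u, by simp [← hu, hb]⟩
  have hr : IsSquare (a * a + b * b) := by
    rcases IsRealClosed.isSquare_or_isSquare_neg (a * a + b * b) with h | ⟨r, hr⟩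
    · exact h
    · have := aux_cancel hsr (a := b) (s := a * a + r * r) (.sq_add _ (.mul_self _))
        (by linear_combination -hr)
      exact absurd this hb
  obtain ⟨r, hr⟩ := hr
  have hc0 : a + r ≠ 0 := fun h0 => hb (by
    have : b * b = 0 := by linear_combination hr + (r - a) * h0
    simpa using this)
  rcases IsRealClosed.isSquare_or_isSquare_neg ((a + r) / 2) with ⟨u, hu⟩ | ⟨u, hu⟩
  · have hu0 : u ≠ 0 := by rintro rfl; apply hc0; linear_combination 2 * hu
    refine ⟨u, b / (2 * u), ?_, by field_simp⟩
    have e2 : a + r = 2 * (u * u) := by linear_combination 2 * hu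
    field_simp
    have : r = 2 * (u * u) - a := by linear_combination e2
    rw [this] at hr
    linear_combination -hr
  · have hu0 : u ≠ 0 := by rintro rfl; apply hc0; linear_combination -2 * hu
    refine ⟨b / (2 * u), u, ?_, by field_simp⟩
    have : r = -2 * (u * u) - a := by linear_combination -2 * hu
    rw [this] at hr
    field_simp
    linear_combination hr

theorem aux_sylow {K L : Type*} [Field K] [Field L] [Algebra K L] [IsRealClosed K]
    [FiniteDimensional K L] [IsGalois K L] : ∃ n, Module.finrank K L = 2 ^ n := by
  have : Fact (Nat.Prime 2) := ⟨Nat.prime_two⟩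
  let H : Sylow 2 Gal(L/K) := default
  have hodd : ¬ 2 ∣ (H : Subgroup Gal(L/K)).index := H.not_dvd_index
  let E := fixedField (H : Subgroup Gal(L/K))
  have h1 : Module.finrank K E = (H : Subgroup Gal(L/K)).index := by
    rw [finrank_eq_fixingSubgroup_index, fixingSubgroup_fixedField]
  have h2 : Module.finrank K E = 1 := by
    obtain ⟨x, hx⟩ := Field.exists_primitive_element K E
    have hint : IsIntegral K x := Algebra.IsIntegral.isIntegral x
    have hd : (minpoly K x).natDegree = Module.finrank K E := by
      rw [← adjoin.finrank hint, hx, finrank_top']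
    have ho : Odd (minpoly K x).natDegree := by
      rw [hd, h1]; exact Nat.not_even_iff_odd.1 (fun h => hodd h.two_dvd)
    obtain ⟨y, hy⟩ := IsRealClosed.exists_isRoot_of_odd_natDegree ho
    rw [← hd]
    exact natDegree_eq_of_degree_eq_some (degree_eq_one_of_irreducible_of_root (minpoly.irreducible hint) hy)
  rw [h1] at h2
  obtain ⟨n, hn⟩ := IsPGroup.iff_card.1 H.isPGroup'
  refine ⟨n, ?_⟩
  rw [← IsGalois.card_aut_eq_finrank, ← hn, ← Subgroup.card_mul_index (H : Subgroup Gal(L/K)), h2,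
    mul_one]

theorem aux_two_ext {K L : Type*} [Field K] [Field L] [Algebra K L] [CharZero K]
    (hsq : ∀ z : K, IsSquare z)
    [FiniteDimensional K L] [IsGalois K L] (n : ℕ) (hn : Module.finrank K L = 2 ^ n) : n = 0 := by
  have : Fact (Nat.Prime 2) := ⟨Nat.prime_two⟩
  by_contra h0
  obtain ⟨m, rfl⟩ := Nat.exists_eq_succ_of_ne_zero h0
  rw [← IsGalois.card_aut_eq_finrank] at hn
  obtain ⟨H, hH⟩ := Sylow.exists_subgroup_card_pow_prime (G := Gal(L/K)) 2 (n := m)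
    (by rw [hn]; exact pow_dvd_pow 2 (by lia))
  have h2 : H.index = 2 := by
    have := H.card_mul_index
    rw [hH, hn, pow_succ] at this
    exact Nat.eq_of_mul_eq_mul_left (by positivity) this
  let E := fixedField H
  have h1 : Module.finrank K E = 2 := by
    rw [finrank_eq_fixingSubgroup_index, fixingSubgroup_fixedField, h2]
  obtain ⟨x, hx⟩ := Field.exists_primitive_element K E
  have hint : IsIntegral K x := Algebra.IsIntegral.isIntegral x
  have hd : (minpoly K x).natDegree = 2 := by
    rw [← adjoin.finrank hint, hx, finrank_top', h1]
  set f := minpoly K x with hf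
  obtain ⟨s, hs⟩ := hsq (discrim (f.coeff 2) (f.coeff 1) (f.coeff 0))
  have hlc : f.coeff 2 ≠ 0 := by
    rw [← hd]; simpa using minpoly.ne_zero hint
  obtain ⟨y, hy⟩ := exists_quadratic_eq_zero hlc ⟨s, hs⟩
  have hroot : f.IsRoot y := by
    rw [IsRoot, eval_eq_sum_range, hd]
    simp [Finset.sum_range_succ]
    linear_combination hy
  have : f.natDegree = 1 := natDegree_eq_of_degree_eq_some (degree_eq_one_of_irreducible_of_root (minpoly.irreducible hint) hroot)
  lia

theorem aux_top {K L : Type*} [Field K] [Field L] [Algebra K L] [IsRealClosed K]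
    [FiniteDimensional K L] [IsGalois K L] {i : L} (hi : i * i = -1) : K⟮i⟯ = ⊤ := by
  have : CharZero K := inferInstance
  have : CharZero K⟮i⟯ := charZero_of_injective_algebraMap (algebraMap K K⟮i⟯).injective
  obtain ⟨n, hn⟩ := aux_sylow (K := K) (L := L)
  have hdvd : Module.finrank K⟮i⟯ L ∣ 2 ^ n := by
    rw [← hn, ← Module.finrank_mul_finrank K K⟮i⟯ L]; exact dvd_mul_left _ _
  obtain ⟨m, -, hm⟩ := (Nat.dvd_prime_pow Nat.prime_two).1 hdvd
  have := aux_two_ext (K := K⟮i⟯) (L := L) (aux_sqK hi) m hm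
  subst this
  rw [pow_zero] at hm
  exact finrank_eq_one_iff_eq_top.1 hm

/-- Every algebraically closed field of characteristic 0 possesses a nonidentity involution. -/
theorem stmt_2 (F : Type*) [Field F] [IsAlgClosed F] [CharZero F] :
    ∃ σ : F ≃+* F, (∀ x, σ (σ x) = x) ∧ ∃ x, σ x ≠ x := by
  obtain ⟨P, hP⟩ := aux_zorn F
  have := aux_rc hP
  have := aux_alg hP
  have : CharZero P := inferInstance
  have : IsAlgClosure P F := ⟨inferInstance, inferInstance⟩
  have : IsGalois P F := ⟨⟩
  obtain ⟨i, hi⟩ := IsAlgClosed.exists_pow_nat_eq (-1 : F) two_pos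
  rw [pow_two] at hi
  have htop : P⟮i⟯ = ⊤ := by
    rw [eq_top_iff]
    intro x _
    let E := IntermediateField.adjoin P {x, i}
    have : FiniteDimensional P E :=
      finiteDimensional_adjoin (fun y _ => Algebra.IsIntegral.isIntegral y)
    let L := normalClosure P E F
    have hEL : E ≤ L := IntermediateField.le_normalClosure E
    have : IsGalois P L := ⟨⟩
    have hxL : x ∈ L := hEL (subset_adjoin P _ (by simp))
    have hiL : i ∈ L := hEL (subset_adjoin P _ (by simp))
    have ht := aux_top (K := P) (L := L) (i := ⟨i, hiL⟩) (Subtype.ext hi)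
    have hm : (⟨x, hxL⟩ : L) ∈ P⟮(⟨i, hiL⟩ : L)⟯ := by rw [ht]; trivial
    obtain ⟨u, v, e⟩ := aux_two (a := (-1 : P)) (by simpa using Subtype.ext hi) ⟨_, hm⟩
    have e' : x = algebraMap P F u + algebraMap P F v * i := congrArg Subtype.val e
    rw [e']
    exact add_mem (IntermediateField.algebraMap_mem _ _) (mul_mem (IntermediateField.algebraMap_mem _ _) (mem_adjoin_simple_self _ _))
  have hiP : i ∉ P := by
    intro h
    apply hP.1
    have : (-1 : P) = ⟨i, h⟩ * ⟨i, h⟩ := Subtype.ext hi.symm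
    rw [this]
    exact .mul_self _
  have hint : IsIntegral P i := Algebra.IsIntegral.isIntegral i
  have : FiniteDimensional P F := by
    have := adjoin.finiteDimensional hint
    rw [htop] at this
    exact Module.Finite.equiv (topEquiv (F := P) (E := F)).toLinearEquiv
  have hfr : Module.finrank P F ≤ 2 := by
    rw [← finrank_top', ← htop, adjoin.finrank hint]
    have hm : (X ^ 2 - C (-1) : P[X]).Monic := monic_X_pow_sub_C _ two_ne_zero
    have h2 := natDegree_le_of_dvd (minpoly.dvd P i (p := X ^ 2 - C (-1)) (by simp [pow_two, hi])) hm.ne_zero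
    rwa [natDegree_X_pow_sub_C] at h2
  rw [← IsGalois.card_aut_eq_finrank] at hfr
  have hex : ∃ σ : Gal(F/P), σ i ≠ i := by
    by_contra! hall
    have := (IsGalois.mem_bot_iff_fixed (F := P) i).2 hall
    obtain ⟨y, hy⟩ := mem_bot.1 this
    exact hiP (hy ▸ y.2)
  obtain ⟨σ, hσ⟩ := hex
  have hcard : Nat.card Gal(F/P) = 2 := by
    have : Nontrivial Gal(F/P) := ⟨σ, 1, by rintro rfl; simp at hσ⟩
    have := Finite.one_lt_card (α := Gal(F/P))
    lia
  have h2 : σ ^ 2 = 1 := by rw [← hcard]; exact pow_card_eq_one'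
  refine ⟨σ.toRingEquiv, fun x => ?_, i, hσ⟩
  have := DFunLike.congr_fun h2 x
  simpa [pow_two] using this
end

section
/- Let F be an algebraically closed field of characteristic different from 2, and let B be the n×n tridiagonal matrix with diagonal (1, 0, 0, …, 0), superdiagonal all 1's, and subdiagonal (-1, 1, -1, 1, …) (alternating starting with -1). Then the pair (Bᵀ, B) is equivalent to (I_n, J_n((-1)^{n+1})); that is, B⁻ᵀ·B is similar to J_n((-1)^{n+1}). -/
open Matrix

/-- Equivalence of pairs of square matrices. -/
def PairEquiv {F : Type*} [Field F] {n : ℕ} (A B A' B' : Matrix (Fin n) (Fin n) F) : Prop :=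
  ∃ R S : Matrix (Fin n) (Fin n) F, IsUnit R ∧ IsUnit S ∧ R * A * S = A' ∧ R * B * S = B'

/-- The `n×n` Jordan block `J_n(λ)`. -/
def Jmat (F : Type*) [Field F] (n : ℕ) (lam : F) : Matrix (Fin n) (Fin n) F :=
  Matrix.of fun i j => if i = j then lam else if (j : ℕ) = (i : ℕ) + 1 then 1 else 0


lemma aux_pow {F : Type*} [Field F] {n : ℕ} (M : Matrix (Fin n) (Fin n) F)
    (h0 : ∀ i j : Fin n, j ≤ i → M i j = 0)
    (h1 : ∀ i j : Fin n, (j : ℕ) = i + 1 → M i j ≠ 0) (l : Fin n) (hl : (l : ℕ) + 1 = n) (k : ℕ) :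
    (∀ i : Fin n, n ≤ (i : ℕ) + k → (M ^ k) i l = 0) ∧
    (∀ i : Fin n, n = (i : ℕ) + k + 1 → (M ^ k) i l ≠ 0) := by
  induction k with
  | zero =>
    refine ⟨fun i hi => by have := i.2; omega, fun i hi => ?_⟩
    have : i = l := Fin.ext (by omega)
    subst this
    simp
  | succ k ih =>
    obtain ⟨ih0, ih1⟩ := ih
    refine ⟨fun i hi => ?_, fun i hi => ?_⟩
    · rw [pow_succ', Matrix.mul_apply]
      refine Finset.sum_eq_zero fun j _ => ?_
      by_cases hj : j ≤ i
      · rw [h0 i j hj, zero_mul]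
      · have : (i : ℕ) < j := by simpa using hj
        rw [ih0 j (by omega), mul_zero]
    · rw [pow_succ', Matrix.mul_apply]
      rw [Finset.sum_eq_single (⟨i + 1, by omega⟩ : Fin n)]
      · exact mul_ne_zero (h1 _ _ rfl) (ih1 _ (by simp; omega))
      · intro j _ hj
        by_cases hj' : j ≤ i
        · rw [h0 i j hj', zero_mul]
        · have : (i : ℕ) < j := by simpa using hj'
          have : (j : ℕ) ≠ i + 1 := fun h => hj (Fin.ext h)
          rw [ih0 j (by omega), mul_zero]
      · simp

lemma aux_tri {F : Type*} [Field F] {n : ℕ} (hn : 0 < n) (T C : Matrix (Fin n) (Fin n) F)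
    (hT0 : ∀ i j : Fin n, j < i → T i j = 0) (hT1 : ∀ i, T i i ≠ 0)
    (hC0 : ∀ i j : Fin n, j ≤ i → C i j = 0)
    (hC1 : ∀ i j : Fin n, (j : ℕ) = i + 1 → C i j ≠ 0) :
    ∃ R S : Matrix (Fin n) (Fin n) F, R * T * S = 1 ∧ R * C * S = Jmat F n 0 := by
  have hTb : T.BlockTriangular id := fun i j h => hT0 i j h
  have hTdet : IsUnit T.det := by
    rw [Matrix.det_of_isUpperTriangular hTb, isUnit_iff_ne_zero]
    exact Finset.prod_ne_zero_iff.2 fun i _ => hT1 i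
  haveI : Invertible T := T.invertibleOfIsUnitDet hTdet
  have hTi : (T⁻¹).BlockTriangular id := Matrix.blockTriangular_inv_of_blockTriangular hTb
  have hTid : ∀ i, T⁻¹ i i ≠ 0 := by
    intro i h
    have h1 : (T⁻¹ * T) i i = 1 := by rw [Matrix.nonsing_inv_mul _ hTdet]; simp
    rw [Matrix.mul_apply, Finset.sum_eq_zero] at h1
    · exact zero_ne_one h1
    · intro j _
      rcases lt_trichotomy j i with hj | hj | hj
      · rw [hTi hj, zero_mul]
      · rw [hj, h, zero_mul]
      · rw [hT0 j i hj, mul_zero]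
  obtain ⟨M, hM⟩ : ∃ M, M = T⁻¹ * C := ⟨_, rfl⟩
  have hTM : T * M = C := by rw [hM, Matrix.mul_nonsing_inv_cancel_left _ _ hTdet]
  have h0 : ∀ i j : Fin n, j ≤ i → M i j = 0 := by
    intro i j hij
    rw [hM, Matrix.mul_apply]
    refine Finset.sum_eq_zero fun k _ => ?_
    by_cases hk : k < i
    · rw [hTi hk, zero_mul]
    · rw [hC0 k j (hij.trans (not_lt.1 hk)), mul_zero]
  have h1 : ∀ i j : Fin n, (j : ℕ) = i + 1 → M i j ≠ 0 := by
    intro i j hij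
    rw [hM, Matrix.mul_apply, Finset.sum_eq_single i]
    · exact mul_ne_zero (hTid i) (hC1 i j hij)
    · intro k _ hk
      by_cases hk' : k < i
      · rw [hTi hk', zero_mul]
      · rw [hC0 k j, mul_zero]
        have : (k : ℕ) ≠ i := fun h => hk (Fin.ext h)
        have : (i : ℕ) ≤ k := by simpa using hk'
        rw [Fin.le_def]; omega
    · simp
  let l : Fin n := ⟨n - 1, by omega⟩
  have hl : (l : ℕ) + 1 = n := by simp [l]; omega
  have hp := aux_pow M h0 h1 l hl
  let S : Matrix (Fin n) (Fin n) F := Matrix.of fun i j => (M ^ (n - 1 - (j : ℕ))) i l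
  have hSb : S.BlockTriangular id := by
    intro i j h
    have : (j : ℕ) < i := h
    exact (hp _).1 i (by omega)
  have hSdet : IsUnit S.det := by
    rw [Matrix.det_of_isUpperTriangular hSb, isUnit_iff_ne_zero]
    exact Finset.prod_ne_zero_iff.2 fun i _ => (hp _).2 i (by omega)
  have hMS : M * S = S * Jmat F n 0 := by
    ext i j
    have e1 : (M * S) i j = (M ^ (n - 1 - (j : ℕ) + 1)) i l := by
      rw [pow_succ', Matrix.mul_apply, Matrix.mul_apply]; rfl
    rw [e1, Matrix.mul_apply]
    by_cases hj : (j : ℕ) = 0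
    · rw [(hp _).1 i (by omega), eq_comm]
      refine Finset.sum_eq_zero fun k _ => ?_
      have : ¬ ((j : ℕ) = k + 1) := by omega
      simp [Jmat, this]
    · rw [Finset.sum_eq_single (⟨j - 1, by omega⟩ : Fin n)]
      · have a : ¬ ((⟨j - 1, by omega⟩ : Fin n) = j) := by
          intro h; have := congrArg Fin.val h; simp at this; omega
        have b : (j : ℕ) = j - 1 + 1 := by omega
        have c : n - 1 - (j : ℕ) + 1 = n - 1 - (j - 1) := by omega
        simp only [Jmat, Matrix.of_apply, S, if_neg a, if_pos b, mul_one, c]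
      · intro k _ hk
        have : ¬ ((j : ℕ) = k + 1) := fun h => hk (Fin.ext (by simp; omega))
        simp [Jmat, this]
      · simp
  have hu : IsUnit (T * S).det := by rw [Matrix.det_mul]; exact hTdet.mul hSdet
  refine ⟨(T * S)⁻¹, S, ?_, ?_⟩
  · rw [Matrix.mul_assoc, Matrix.nonsing_inv_mul _ hu]
  · rw [Matrix.mul_assoc, ← hTM, Matrix.mul_assoc, hMS, ← Matrix.mul_assoc T,
      Matrix.nonsing_inv_mul_cancel_left _ _ hu]

lemma aux_pair {F : Type*} [Field F] {n : ℕ} (hn : 0 < n) (A B : Matrix (Fin n) (Fin n) F)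
    (lam : F) (f g : Fin n → Fin n) (hf : Function.Injective f) (hg : Function.Injective g)
    (hT0 : ∀ i j : Fin n, j < i → A (f i) (g j) = 0) (hT1 : ∀ i, A (f i) (g i) ≠ 0)
    (hC0 : ∀ i j : Fin n, j ≤ i → B (f i) (g j) - lam * A (f i) (g j) = 0)
    (hC1 : ∀ i j : Fin n, (j : ℕ) = i + 1 → B (f i) (g j) - lam * A (f i) (g j) ≠ 0) :
    PairEquiv A B 1 (Jmat F n lam) := by
  let e := Equiv.ofBijective f (Finite.injective_iff_bijective.1 hf)
  let e' := Equiv.ofBijective g (Finite.injective_iff_bijective.1 hg)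
  obtain ⟨R, S, h1, h2⟩ := aux_tri hn (A.submatrix e e') ((B - lam • A).submatrix e e')
    hT0 hT1 hC0 hC1
  have key : ∀ X : Matrix (Fin n) (Fin n) F,
      R.submatrix id e.symm * X * S.submatrix e'.symm id = R * X.submatrix e e' * S := by
    intro X
    have hX : X = (X.submatrix e e').submatrix e.symm e'.symm := by ext; simp
    conv_lhs => rw [hX]
    rw [Matrix.submatrix_mul_equiv, Matrix.submatrix_mul_equiv, Matrix.submatrix_id_id]
  have k1 := (key A).trans h1
  have k2 := (key _).trans h2
  refine ⟨_, _, ?_, ?_, k1, ?_⟩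
  · rw [Matrix.mul_assoc] at k1
    exact IsUnit.of_mul_eq_one _ k1
  · exact IsUnit.of_mul_eq_one_right _ k1
  · have : B = (B - lam • A) + lam • A := by simp
    rw [this, Matrix.mul_add, Matrix.add_mul, k2, Matrix.mul_smul, Matrix.smul_mul, k1]
    ext i j
    by_cases h : i = j <;> simp [Jmat, h, Matrix.one_apply]

set_option maxHeartbeats 4000000 in
/-- For the `n×n` tridiagonal matrix `B` with diagonal `(1,0,…,0)`, superdiagonal
all `1` and subdiagonal `(-1,1,-1,1,…)`, the pair `(Bᵀ, B)` is equivalent to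
`(I_n, J_n((-1)^{n+1}))`. -/
theorem stmt_12 (F : Type*) [Field F] [IsAlgClosed F] (hchar : ringChar F ≠ 2)
    (n : ℕ) (hn : 0 < n) :
    PairEquiv
      (Matrix.of fun i j : Fin n =>
        if i = j then (if (i : ℕ) = 0 then (1 : F) else 0)
        else if (j : ℕ) = (i : ℕ) + 1 then 1
        else if (i : ℕ) = (j : ℕ) + 1 then (if (j : ℕ) % 2 = 0 then -1 else 1)
        else 0)ᵀ
      (Matrix.of fun i j : Fin n =>
        if i = j then (if (i : ℕ) = 0 then (1 : F) else 0)
        else if (j : ℕ) = (i : ℕ) + 1 then 1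
        else if (i : ℕ) = (j : ℕ) + 1 then (if (j : ℕ) % 2 = 0 then -1 else 1)
        else 0)
      (1 : Matrix (Fin n) (Fin n) F)
      (Jmat F n ((-1) ^ (n + 1))) := by
  have h2 : (2 : F) ≠ 0 := Ring.two_ne_zero hchar
  let g : Fin n → Fin n := fun k =>
    if h : 2 * (k : ℕ) ≤ n - 1 then ⟨n - 1 - 2 * k, by omega⟩ else ⟨2 * k - n, by omega⟩
  let f : Fin n → Fin n := fun k =>
    if h : 2 * (k : ℕ) + 2 ≤ n then ⟨n - 2 - 2 * k, by omega⟩ else ⟨2 * k + 1 - n, by omega⟩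
  have gv : ∀ k, (g k : ℕ) = if 2 * (k : ℕ) ≤ n - 1 then n - 1 - 2 * k else 2 * k - n := by
    intro k; simp only [g]; split_ifs <;> rfl
  have fv : ∀ k, (f k : ℕ) = if 2 * (k : ℕ) + 2 ≤ n then n - 2 - 2 * k else 2 * k + 1 - n := by
    intro k; simp only [f]; split_ifs <;> rfl
  have hlam : ((-1 : F)) ^ (n + 1) = if n % 2 = 0 then -1 else 1 := by
    split_ifs with h
    · exact Odd.neg_one_pow (Nat.odd_iff.2 (by omega))
    · exact Even.neg_one_pow (Nat.even_iff.2 (by omega))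
  have h11 : (1 : F) + 1 ≠ 0 := by rwa [one_add_one_eq_two]
  have h12 : (-1 : F) - 1 ≠ 0 := by
    intro h; apply h11; linear_combination -h
  apply aux_pair hn _ _ _ f g
  · intro a b h
    have h := congrArg Fin.val h
    rw [fv, fv] at h
    apply Fin.ext
    split_ifs at h <;> omega
  · intro a b h
    have h := congrArg Fin.val h
    rw [gv, gv] at h
    apply Fin.ext
    split_ifs at h <;> omega
  · intro i j hij
    have hij : (j : ℕ) < i := hij
    have fi := fv i
    have gj := gv j
    simp only [Matrix.transpose_apply, Matrix.of_apply, Fin.ext_iff]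
    generalize (f i : ℕ) = x at *
    generalize (g j : ℕ) = y at *
    split_ifs at fi gj ⊢ <;> first | rfl | (exfalso; omega)
  · intro i
    have fi := fv i
    have gj := gv i
    simp only [Matrix.transpose_apply, Matrix.of_apply, Fin.ext_iff]
    generalize (f i : ℕ) = x at *
    generalize (g i : ℕ) = y at *
    split_ifs at fi gj ⊢ <;> first | (exfalso; omega) | simp
  · intro i j hij
    have hij : (j : ℕ) ≤ i := hij
    have fi := fv i
    have gj := gv j
    rw [hlam]
    simp only [Matrix.transpose_apply, Matrix.of_apply, Fin.ext_iff]
    generalize (f i : ℕ) = x at *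
    generalize (g j : ℕ) = y at *
    split_ifs at fi gj ⊢ <;> first | (exfalso; omega) | simp
  · intro i j hij
    have fi := fv i
    have gj := gv j
    rw [hlam]
    simp only [Matrix.transpose_apply, Matrix.of_apply, Fin.ext_iff]
    generalize (f i : ℕ) = x at *
    generalize (g j : ℕ) = y at *
    split_ifs at fi gj ⊢ <;> first | (exfalso; omega) | (simpa using h11) | (simpa using h12) | (norm_num; exact h2)
end

section
/- Let F be an algebraically closed field of characteristic different from 2, λ ∈ F nonzero, and k a positive integer. Let A be the 2k×2k symmetric tridiagonal matrix with zero diagonal and all off-diagonal entries 1, and let B be the 2k×2k skew-symmetric tridiagonal matrix with superdiagonal entries λ and subdiagonal entries -λ. Then the pair (A, B) is equivalent to (I_k, J_k(λ)) ⊕ (I_k, J_k(-λ)). -/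
open Matrix

/-- Tridiagonal row sum. -/
lemma tri_sum {F : Type*} [Field F] (m : ℕ) (i : ℕ) (α β : F) (g : ℕ → F)
    (hi : i < m) (hg : ∀ n, m ≤ n → g n = 0) :
    ∑ j : Fin m, (if (j : ℕ) = i + 1 then α else if i = (j : ℕ) + 1 then β else 0) * g j
      = α * g (i + 1) + (if i = 0 then 0 else β * g (i - 1)) := by
  rw [Fin.sum_univ_eq_sum_range
    (fun j => (if j = i + 1 then α else if i = j + 1 then β else 0) * g j) m]
  have h : ∀ j ∈ Finset.range m, (if j = i + 1 then α else if i = j + 1 then β else 0) * g j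
      = (if j = i + 1 then α * g (i + 1) else 0)
        + (if j = i - 1 then (if i = 0 then 0 else β * g (i - 1)) else 0) := by
    intro j _
    by_cases h1 : j = i + 1
    · have : ¬ (i + 1 = i - 1) := by omega
      subst h1
      simp [this]
    · by_cases h2 : i = j + 1
      · subst h2
        simp [h1]
      · by_cases h3 : j = i - 1
        · have h4 : i = 0 := by omega
          subst h4
          have h5 : j = 0 := by omega
          subst h5
          simp
        · simp [h1, h2, h3]
  rw [Finset.sum_congr rfl h, Finset.sum_add_distrib, Finset.sum_ite_eq', Finset.sum_ite_eq']
  have h4 : i - 1 < m := by omega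
  by_cases h5 : i + 1 < m
  · simp [h4, h5]
  · simp [h4, h5, hg (i + 1) (by omega)]

/-- Column sum against a bidiagonal matrix. -/
lemma bi_sum {F : Type*} [Field F] (m k : ℕ) (j : ℕ) (μ : ℕ → F) (g : ℕ → F) (hj : j < m) :
    ∑ l : Fin m, g l * (if (l : ℕ) = j then μ l
        else if j = (l : ℕ) + 1 ∧ j ≠ k then 1 else 0)
      = g j * μ j + (if j = 0 ∨ j = k then 0 else g (j - 1)) := by
  rw [Fin.sum_univ_eq_sum_range
    (fun l => g l * (if l = j then μ l else if j = l + 1 ∧ j ≠ k then 1 else 0)) m]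
  have h : ∀ l ∈ Finset.range m, g l * (if l = j then μ l
        else if j = l + 1 ∧ j ≠ k then 1 else 0)
      = (if l = j then g j * μ j else 0)
        + (if l = j - 1 then (if j = 0 ∨ j = k then 0 else g (j - 1)) else 0) := by
    intro l _
    by_cases h1 : l = j
    · subst h1
      by_cases h2 : l = 0
      · simp [h2]
      · have : ¬ (l = l - 1) := by omega
        simp [this]
    · by_cases h2 : j = l + 1
      · subst h2
        by_cases h3 : l + 1 = k
        · subst h3
          simp
        · simp [h3]
      · by_cases h3 : l = j - 1
        · exact absurd (show l = j by omega) h1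
        · simp [h1, h2, h3]
  rw [Finset.sum_congr rfl h, Finset.sum_add_distrib, Finset.sum_ite_eq', Finset.sum_ite_eq']
  have h4 : j - 1 < m := by omega
  simp [h4, hj]

/-- Entries of the transforming matrix. -/
def sEnt {F : Type*} [Field F] (k : ℕ) (c : F) (i j : ℕ) : F :=
  if j < k then (if i % 2 = 1 ∧ i < 2 * k then (-c) ^ j * (j.choose (k - 1 - i / 2) : F) else 0)
  else (if i % 2 = 0 ∧ i < 2 * k then c ^ (j - k) * ((j - k).choose (i / 2) : F) else 0)

lemma sEnt_rel {F : Type*} [Field F] (k : ℕ) (lam c : F) (hc : 2 * lam * c = 1)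
    (i j : ℕ) (hi : i < 2 * k) (hj : j < 2 * k) :
    lam * sEnt k c (i + 1) j + (if i = 0 then 0 else (-lam) * sEnt k c (i - 1) j)
    = (1 * sEnt k c (i + 1) j + (if i = 0 then 0 else 1 * sEnt k c (i - 1) j))
        * (if j < k then lam else -lam)
      + (if j = 0 ∨ j = k then 0 else
        (1 * sEnt k c (i + 1) (j - 1) + (if i = 0 then 0 else 1 * sEnt k c (i - 1) (j - 1)))) := by
  obtain ⟨a, rfl | rfl⟩ : ∃ a, i = 2 * a ∨ i = 2 * a + 1 := ⟨i / 2, by omega⟩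
  · have e1 : (2 * a + 1) % 2 = 1 := by omega
    have e2 : (2 * a + 1) / 2 = a := by omega
    have e3 : 2 * a + 1 < 2 * k := by omega
    by_cases hjk : j < k
    · have hjk1 : j - 1 < k := by omega
      have hne : j ≠ k := by omega
      rcases Nat.eq_zero_or_pos a with rfl | ha
      · rcases j with _ | j
        · simp [sEnt, hjk]; ring
        · have : (j.choose (k - 1)) = 0 := Nat.choose_eq_zero_of_lt (by omega)
          have h' : j < k := by omega
          simp [sEnt, hjk, hne, this, h']; ring
      · obtain ⟨p, rfl⟩ : ∃ p, k = p + a + 1 := ⟨k - 1 - a, by omega⟩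
        have f1 : (2 * a - 1) % 2 = 1 := by omega
        have f2 : (2 * a - 1) / 2 = a - 1 := by omega
        have f3 : 2 * a - 1 < 2 * (p + a + 1) := by omega
        have f4 : p + a + 1 - 1 - a = p := by omega
        have f5 : p + a + 1 - 1 - (a - 1) = p + 1 := by omega
        have f6 : 2 * a ≠ 0 := by omega
        rcases j with _ | j
        · simp only [sEnt, e1, e2, e3, f1, f2, f3, f4, f5, f6, hjk, if_true, if_false, and_self,
            true_or, Nat.choose_zero_succ]
          push_cast; ring
        · simp only [Nat.add_sub_cancel] at hjk1
          have f7 : p + a - (a - 1) = p + 1 := by omega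
          simp only [sEnt, e1, e2, e3, f1, f2, f3, f4, f5, f6, hjk, if_true, if_false, and_self,
            hne, Nat.succ_ne_zero, or_self, Nat.add_sub_cancel, hjk1, f7, Nat.choose_succ_succ']
          push_cast
          linear_combination (-c) ^ j * ((j.choose p : F) + j.choose (p + 1)) * hc
    · have g : (2 * a - 1) % 2 = 0 → 2 * a = 0 := by omega
      have h1 : ∀ j, ¬ j < k → sEnt k c (2 * a + 1) j = 0 := by
        intro j h; simp [sEnt, h]
      have h2 : ∀ j, ¬ j < k → (2 * a ≠ 0) → sEnt k c (2 * a - 1) j = 0 := by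
        intro j h h0
        have : ¬ (2 * a - 1) % 2 = 0 := fun h => h0 (g h)
        simp [sEnt, h, this]
      by_cases h0 : 2 * a = 0
      · by_cases h3 : j = 0 ∨ j = k
        · rw [h1 j hjk, if_pos h0, if_pos h0, if_pos h3]; simp
        · have := h1 (j - 1) (by omega)
          rw [h1 j hjk, this, if_pos h0, if_pos h0, if_pos h0, if_neg h3]; simp
      · by_cases h3 : j = 0 ∨ j = k
        · simp only [h1 j hjk, h2 j hjk h0, h3, h0, if_true, if_false]; simp
        · have h4 := h1 (j - 1) (by omega)
          have h5 := h2 (j - 1) (by omega) h0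
          simp only [h1 j hjk, h2 j hjk h0, h3, h0, h4, h5, if_true, if_false]; simp
  · have e0 : 2 * a + 1 ≠ 0 := by omega
    have e1 : (2 * a + 1 + 1) % 2 = 0 := by omega
    have e2 : (2 * a + 1 + 1) / 2 = a + 1 := by omega
    have e3 : (2 * a) % 2 = 0 := by omega
    have e4 : (2 * a) / 2 = a := by omega
    have e5 : 2 * a < 2 * k := by omega
    by_cases hjk : j < k
    · have h1 : j - 1 < k := by omega
      simp [sEnt, hjk, h1, e1]
    · obtain ⟨j, rfl⟩ : ∃ q, j = k + q := ⟨j - k, by omega⟩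
      have key : ∀ q, q < k → sEnt k c (2 * a + 1 + 1) (k + q)
          = c ^ q * (q.choose (a + 1) : F) := by
        intro q hq
        have : ¬ (k + q < k) := by omega
        by_cases h : 2 * a + 1 + 1 < 2 * k
        · simp only [sEnt, this, e1, e2, h, if_true, if_false, and_self, Nat.add_sub_cancel_left]
        · have h' : q.choose (a + 1) = 0 := Nat.choose_eq_zero_of_lt (by omega)
          simp only [sEnt, this, e1, h, if_false, and_false, h']; simp
      have key2 : ∀ q, sEnt k c (2 * a) (k + q) = c ^ q * (q.choose a : F) := by
        intro q
        have : ¬ (k + q < k) := by omega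
        simp only [sEnt, this, e3, e4, e5, if_true, if_false, and_self, Nat.add_sub_cancel_left]
      rcases j with _ | j
      · simp only [Nat.add_sub_cancel, e0, if_false, add_zero, or_true, if_true, lt_irrefl]
        have K := key 0 (by omega)
        have K2 := key2 0
        simp only [add_zero] at K K2
        rw [K, K2]
        simp only [Nat.choose_zero_succ]
        push_cast; ring
      · have n1 : ¬ (k + (j + 1) = 0 ∨ k + (j + 1) = k) := by omega
        have n2 : k + (j + 1) - 1 = k + j := by omega
        simp only [Nat.add_sub_cancel, n1, n2, hjk, e0, if_false, key (j + 1) (by omega),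
          key j (by omega), key2, Nat.choose_succ_succ']
        push_cast
        linear_combination c ^ j * ((j.choose a : F) + j.choose (a + 1)) * hc

lemma sMat_unit {F : Type*} [Field F] (k : ℕ) (c : F) (hc : c ≠ 0) :
    IsUnit (Matrix.of fun i j : Fin (2 * k) => sEnt k c i j) := by
  let f : Fin (2 * k) → Fin (2 * k) := fun i =>
    if h : (i : ℕ) < k then ⟨2 * k - 1 - 2 * i, by omega⟩ else ⟨2 * (i - k), by omega⟩
  have hf : ∀ i, (f i : ℕ) = if (i : ℕ) < k then 2 * k - 1 - 2 * i else 2 * (i - k) := by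
    intro i; by_cases h : (i : ℕ) < k <;> simp [f, h]
  have hinj : Function.Injective f := by
    intro x y hxy
    have h := congrArg (fun z : Fin (2 * k) => (z : ℕ)) hxy
    simp only [hf] at h
    apply Fin.ext
    split_ifs at h <;> omega
  let e : Fin (2 * k) ≃ Fin (2 * k) := Equiv.ofBijective f (Finite.injective_iff_bijective.1 hinj)
  set S := (Matrix.of fun i j : Fin (2 * k) => sEnt k c i j) with hS
  have hent : ∀ i j : Fin (2 * k), S.submatrix e id i j =
      if (i : ℕ) < k then (if (j : ℕ) < k then (-c) ^ (j : ℕ) * ((j : ℕ).choose i : F) else 0)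
      else (if (j : ℕ) < k then 0 else c ^ ((j : ℕ) - k) * (((j : ℕ) - k).choose (i - k) : F)) := by
    intro i j
    have h0 : S.submatrix e id i j = sEnt k c (f i) j := rfl
    rw [h0, hf]
    by_cases h : (i : ℕ) < k
    · have h1 : (2 * k - 1 - 2 * (i : ℕ)) % 2 = 1 := by omega
      have h2 : (2 * k - 1 - 2 * (i : ℕ)) < 2 * k := by omega
      have h3 : k - 1 - (2 * k - 1 - 2 * (i : ℕ)) / 2 = i := by omega
      simp only [h, sEnt, h1, h2, h3, if_true, and_self]
      simp
    · have h1 : (2 * ((i : ℕ) - k)) % 2 = 0 := by omega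
      have h2 : (2 * ((i : ℕ) - k)) < 2 * k := by omega
      have h3 : (2 * ((i : ℕ) - k)) / 2 = i - k := by omega
      simp only [h, sEnt, h1, h2, h3, if_true, if_false, and_self]
      simp
  have hdet : (S.submatrix e id).det ≠ 0 := by
    rw [Matrix.det_of_isUpperTriangular]
    · apply Finset.prod_ne_zero_iff.2
      intro i _
      rw [hent]
      by_cases h : (i : ℕ) < k <;> simp [h, hc]
    · intro i j hij
      have hij' : (j : ℕ) < i := hij
      rw [hent]
      by_cases h : (i : ℕ) < k
      · have : (j : ℕ).choose i = 0 := Nat.choose_eq_zero_of_lt hij'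
        simp [h, this]
      · by_cases h2 : (j : ℕ) < k
        · simp [h, h2]
        · have : ((j : ℕ) - k).choose (i - k) = 0 := Nat.choose_eq_zero_of_lt (by omega)
          simp [h, h2, this]
  rw [Matrix.isUnit_iff_isUnit_det, isUnit_iff_ne_zero]
  intro h
  apply hdet
  rw [Matrix.det_permute, h, mul_zero]

lemma aMat_unit {F : Type*} [Field F] (k : ℕ) :
    IsUnit (Matrix.of fun i j : Fin (2 * k) =>
      if (j : ℕ) = (i : ℕ) + 1 then (1 : F) else if (i : ℕ) = (j : ℕ) + 1 then 1 else 0) := by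
  rw [← Matrix.mulVec_injective_iff_isUnit, ← Matrix.coe_mulVecLin, injective_iff_map_eq_zero]
  intro v hv
  let w : ℕ → F := fun n => if h : n < 2 * k then v ⟨n, h⟩ else 0
  have hw : ∀ n, 2 * k ≤ n → w n = 0 := by
    intro n hn
    have : ¬ n < 2 * k := by omega
    simp [w, this]
  have hwv : ∀ i : Fin (2 * k), w i = v i := by intro i; simp [w]
  have hrec : ∀ i, i < 2 * k → w (i + 1) + (if i = 0 then 0 else w (i - 1)) = 0 := by
    intro i hi
    have h := congrFun hv ⟨i, hi⟩
    have h2 := tri_sum (2 * k) i (1 : F) 1 w hi hw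
    simp only [one_mul] at h2
    rw [← h2]
    simpa [Matrix.mulVec, dotProduct, hwv] using h
  have hodd : ∀ a, w (2 * a + 1) = 0 := by
    intro a
    induction a with
    | zero =>
      rcases Nat.eq_zero_or_pos k with h | h
      · exact hw _ (by omega)
      · simpa using hrec 0 (by omega)
    | succ a ih =>
      by_cases h : 2 * (a + 1) < 2 * k
      · have := hrec _ h
        have e : 2 * (a + 1) - 1 = 2 * a + 1 := by omega
        rw [e, ih] at this
        simpa using this
      · exact hw _ (by omega)
  have heven : ∀ b a, k ≤ a + b → w (2 * a) = 0 := by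
    intro b
    induction b with
    | zero => intro a h; exact hw _ (by omega)
    | succ b ih =>
      intro a h
      by_cases h1 : 2 * a + 1 < 2 * k
      · have := hrec _ h1
        have e : 2 * a + 1 + 1 = 2 * (a + 1) := by omega
        rw [e, ih (a + 1) (by omega)] at this
        simpa using this
      · exact hw _ (by omega)
  funext i
  rw [← hwv]
  obtain ⟨a, h | h⟩ : ∃ a, (i : ℕ) = 2 * a ∨ (i : ℕ) = 2 * a + 1 := ⟨i / 2, by omega⟩
  · rw [h]; exact heven k a (by omega)
  · rw [h]; exact hodd a

/-- For `λ ≠ 0`, the pair `(A, B)` with `A` the `2k×2k` symmetric tridiagonal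
matrix with zero diagonal and all off-diagonal entries `1`, and `B` the
skew-symmetric tridiagonal matrix with superdiagonal `λ` and subdiagonal `-λ`,
is equivalent to `(I_k, J_k(λ)) ⊕ (I_k, J_k(-λ))`. -/
theorem stmt_15 (F : Type*) [Field F] [IsAlgClosed F] (hchar : ringChar F ≠ 2)
    (k : ℕ) (hk : 0 < k) (lam : F) (hlam : lam ≠ 0) :
    PairEquiv
      (Matrix.of fun i j : Fin (2 * k) =>
        if (j : ℕ) = (i : ℕ) + 1 ∨ (i : ℕ) = (j : ℕ) + 1 then (1 : F) else 0)
      (Matrix.of fun i j : Fin (2 * k) =>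
        if (j : ℕ) = (i : ℕ) + 1 then lam
        else if (i : ℕ) = (j : ℕ) + 1 then -lam else 0)
      (1 : Matrix (Fin (2 * k)) (Fin (2 * k)) F)
      -- J_k(λ) ⊕ J_k(-λ)
      (Matrix.of fun i j : Fin (2 * k) =>
        if i = j then (if (i : ℕ) < k then lam else -lam)
        else if (j : ℕ) = (i : ℕ) + 1 ∧ (j : ℕ) ≠ k then 1 else 0) := by
  have h2 : (2 : F) ≠ 0 := Ring.two_ne_zero hchar
  obtain ⟨c, hc⟩ : ∃ c : F, 2 * lam * c = 1 := ⟨(2 * lam)⁻¹, mul_inv_cancel₀ (mul_ne_zero h2 hlam)⟩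
  have hc0 : c ≠ 0 := by rintro rfl; simp at hc
  have hA : (Matrix.of fun i j : Fin (2 * k) =>
        if (j : ℕ) = (i : ℕ) + 1 ∨ (i : ℕ) = (j : ℕ) + 1 then (1 : F) else 0)
      = (Matrix.of fun i j : Fin (2 * k) =>
      if (j : ℕ) = (i : ℕ) + 1 then (1 : F) else if (i : ℕ) = (j : ℕ) + 1 then 1 else 0) := by
    ext i j
    simp only [Matrix.of_apply]
    split_ifs <;> first | rfl | omega
  rw [hA]
  have hAu := aMat_unit (F := F) k
  have hSu := sMat_unit (F := F) k c hc0
  have hg : ∀ j, ∀ n, 2 * k ≤ n → sEnt k c n j = 0 := by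
    intro j n hn
    have : ¬ n < 2 * k := by omega
    simp [sEnt, this]
  have hAS : ∀ i j : Fin (2 * k), ((Matrix.of fun i j : Fin (2 * k) =>
      if (j : ℕ) = (i : ℕ) + 1 then (1 : F) else if (i : ℕ) = (j : ℕ) + 1 then 1 else 0) *
      (Matrix.of fun i j : Fin (2 * k) => sEnt k c i j)) i j
      = 1 * sEnt k c (i + 1) j + (if (i : ℕ) = 0 then 0 else 1 * sEnt k c (i - 1) j) := by
    intro i j
    rw [Matrix.mul_apply]
    exact tri_sum (2 * k) i 1 1 (fun n => sEnt k c n j) i.2 (hg j)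
  have hBS : (Matrix.of fun i j : Fin (2 * k) =>
        if (j : ℕ) = (i : ℕ) + 1 then lam
        else if (i : ℕ) = (j : ℕ) + 1 then -lam else 0) *
      (Matrix.of fun i j : Fin (2 * k) => sEnt k c i j) =
      ((Matrix.of fun i j : Fin (2 * k) =>
      if (j : ℕ) = (i : ℕ) + 1 then (1 : F) else if (i : ℕ) = (j : ℕ) + 1 then 1 else 0) *
      (Matrix.of fun i j : Fin (2 * k) => sEnt k c i j)) *
      (Matrix.of fun i j : Fin (2 * k) =>
        if i = j then (if (i : ℕ) < k then lam else -lam)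
        else if (j : ℕ) = (i : ℕ) + 1 ∧ (j : ℕ) ≠ k then 1 else 0) := by
    ext i j
    rw [Matrix.mul_apply, Matrix.mul_apply]
    simp only [hAS, Matrix.of_apply]
    have e1 := tri_sum (2 * k) i lam (-lam) (fun n => sEnt k c n j) i.2 (hg j)
    have e2 := bi_sum (2 * k) k j (fun l => if l < k then lam else -lam)
      (fun l => 1 * sEnt k c (i + 1) l + (if (i : ℕ) = 0 then 0 else 1 * sEnt k c (i - 1) l)) j.2
    simp only [Fin.ext_iff]
    exact e1.trans ((sEnt_rel k lam c hc i j i.2 j.2).trans e2.symm)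
  have hTu := hAu.mul hSu
  refine ⟨_, _, (Matrix.isUnit_nonsing_inv_iff.2 hTu), hSu, ?_, ?_⟩
  · rw [Matrix.mul_assoc]
    exact Matrix.nonsing_inv_mul _ ((Matrix.isUnit_iff_isUnit_det _).1 hTu)
  · rw [Matrix.mul_assoc, hBS, ← Matrix.mul_assoc,
      Matrix.nonsing_inv_mul _ ((Matrix.isUnit_iff_isUnit_det _).1 hTu), Matrix.one_mul]
end
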